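/- arXiv:1905.04187 — 2 statements merged into one kernel-verified Lean document; each statement's English description precedes it below -/
import Mathlib

section
/- Fix integers n ≥ 1 and d₁, d₂ ≥ 1. There exists a nonzero polynomial P with integer coefficients in m_{d₁} + m_{d₂} variables (one variable for each coefficient of a pair of polynomials of degrees at most d₁ and d₂) such that for all polynomials G, H ∈ ℂ[z₁,…,z_n] with deg G ≤ d₁ and deg H ≤ d₂: if P does not vanish at the combined coefficient vector of (G, H), then for every z ∈ ℂⁿ satisfying H(z) = 0 and z₁(∂H/∂z₁)(z) = z₂(∂H/∂z₂)(z) = ⋯ = z_n(∂H/∂z_n)(z), one has G(z) ≠ 0. -/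
open MvPolynomial

namespace Stmt17

abbrev Idx (n d : ℕ) := {i : Fin n →₀ ℕ // (i.sum fun _ e => e) ≤ d}

instance idxFinite (n d : ℕ) : Finite (Idx n d) :=
  (Finsupp.finite_of_degree_le (σ := Fin n) d).to_subtype

noncomputable instance idxFintype (n d : ℕ) : Fintype (Idx n d) := Fintype.ofFinite _

/-- index of the constant coefficient -/
def i0 (n d : ℕ) : Idx n d := ⟨0, by simp⟩

/-- index of the coefficient of `z_k` -/
noncomputable def i1 (n d : ℕ) (hd : 1 ≤ d) (k : Fin n) : Idx n d :=
  ⟨Finsupp.single k 1, by simpa using hd⟩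

theorem exists_relation {σ τ : Type} [Finite σ] [Finite τ] (hc : Nat.card τ < Nat.card σ)
    (Φ : σ → MvPolynomial τ ℤ) : ∃ P : MvPolynomial σ ℤ, P ≠ 0 ∧ aeval Φ P = 0 := by
  by_contra! hcon
  have hi : AlgebraicIndependent ℤ Φ := by
    rw [algebraicIndependent_iff]
    intro p hp
    by_contra h
    exact hcon p h hp
  have h1 := hi.cardinalMk_le_trdeg
  rw [MvPolynomial.trdeg_of_isDomain, Cardinal.lift_id] at h1
  have := Cardinal.toNat_le_toNat h1 (Cardinal.lt_aleph0_of_finite τ)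
  exact absurd hc (not_lt.mpr this)

section
open Classical

variable {n d₁ d₂ : ℕ} (hd : 1 ≤ d₂)

noncomputable def zz {R : Type} [CommRing R] (S : Finset (Fin n))
    (y : Idx n d₁ ⊕ Idx n d₂ → R) (k : Fin n) : R :=
  if k ∈ S then 0 else y (Sum.inr (i1 n d₂ hd k))

def Lin (S : Finset (Fin n)) (i : Idx n d₂) : Prop := ∃ k, k ∉ S ∧ i.1 = Finsupp.single k 1

noncomputable def ff {R : Type} [CommRing R] (S : Finset (Fin n))
    (y : Idx n d₁ ⊕ Idx n d₂ → R) (k : Fin n) : R :=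
  y (Sum.inr (i0 n d₂)) * ∏ j ∈ Finset.univ.filter (fun j => j ∉ S ∧ j ≠ k), zz hd S y j
  - ∑ i : Idx n d₂, if i.1 = 0 ∨ Lin S i then 0 else
      y (Sum.inr i) * aeval (zz hd S y) (pderiv k (monomial i.1 (1 : ℤ)))

noncomputable def hh {R : Type} [CommRing R] (S : Finset (Fin n))
    (y : Idx n d₁ ⊕ Idx n d₂ → R) (i : Idx n d₂) : R :=
  if h : Lin S i then ff hd S y h.choose else y (Sum.inr i)

noncomputable def phi {R : Type} [CommRing R] (S : Finset (Fin n))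
    (y : Idx n d₁ ⊕ Idx n d₂ → R) : Idx n d₁ ⊕ Idx n d₂ → R
  | Sum.inl i => if i.1 = 0 then - ∑ i' : Idx n d₁, (if i'.1 = 0 then 0 else
      y (Sum.inl i') * aeval (zz hd S y) (monomial i'.1 (1 : ℤ))) else y (Sum.inl i)
  | Sum.inr i => if i.1 = 0 then - ∑ i' : Idx n d₂, (if i'.1 = 0 then 0 else
      hh hd S y i' * aeval (zz hd S y) (monomial i'.1 (1 : ℤ))) else hh hd S y i

variable {R R' : Type} [CommRing R] [CommRing R'] (f : R →+* R') (S : Finset (Fin n))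
    (y : Idx n d₁ ⊕ Idx n d₂ → R)

theorem map_zz (k : Fin n) : f (zz hd S y k) = zz hd S (fun s => f (y s)) k := by
  unfold zz; split_ifs <;> simp

theorem map_aeval_zz (p : MvPolynomial (Fin n) ℤ) :
    f (aeval (zz hd S y) p) = aeval (zz hd S (fun s => f (y s))) p := by
  change f.toIntAlgHom _ = _
  rw [comp_aeval_apply]
  congr 2
  funext k
  exact map_zz hd f S y k

theorem map_ff (k : Fin n) : f (ff hd S y k) = ff hd S (fun s => f (y s)) k := by
  unfold ff
  simp only [map_sub, map_mul, map_prod, map_sum, map_zz, apply_ite f, map_zero, map_aeval_zz]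

theorem map_hh (i) : f (hh hd S y i) = hh hd S (fun s => f (y s)) i := by
  unfold hh
  split_ifs
  · exact map_ff ..
  · rfl

theorem map_phi (s) : f (phi hd S y s) = phi hd S (fun s => f (y s)) s := by
  rcases s with i | i <;> unfold phi <;>
  simp only [map_neg, map_mul, map_sum, apply_ite f, map_zero, map_aeval_zz, map_hh]

theorem exists_P : ∃ P : MvPolynomial (Idx n d₁ ⊕ Idx n d₂) ℤ, P ≠ 0 ∧
    ∀ y : Idx n d₁ ⊕ Idx n d₂ → ℂ, y (Sum.inl (i0 n d₁)) = 0 → aeval (phi hd S y) P = 0 := by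
  let τ := {s : Idx n d₁ ⊕ Idx n d₂ // s ≠ Sum.inl (i0 n d₁)}
  let Y : Idx n d₁ ⊕ Idx n d₂ → MvPolynomial τ ℤ := fun s => if h : s ≠ Sum.inl (i0 n d₁) then
    X ⟨s, h⟩ else 0
  obtain ⟨P, hP, h0⟩ := exists_relation (τ := τ)
    (Finite.card_subtype_lt (x := Sum.inl (i0 n d₁)) (by simp)) (phi hd S Y)
  refine ⟨P, hP, fun y hy => ?_⟩
  have := congrArg (aeval (fun t : τ => y t.1) : MvPolynomial τ ℤ →ₐ[ℤ] ℂ) h0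
  rw [comp_aeval_apply, map_zero] at this
  rw [← this]
  congr 2
  funext s
  refine Eq.symm ((map_phi hd (aeval (fun t : τ => y t.1) :
    MvPolynomial τ ℤ →ₐ[ℤ] ℂ).toRingHom S Y s).trans ?_)
  congr 1
  funext t
  by_cases ht : t = Sum.inl (i0 n d₁)
  · simp [Y, ht, hy]
  · simp [Y, ht]

theorem linear_expand {d : ℕ} (L : MvPolynomial (Fin n) ℂ →ₗ[ℂ] ℂ) (G : MvPolynomial (Fin n) ℂ)
    (hG : G.totalDegree ≤ d) :
    L G = ∑ i : Idx n d, coeff i.1 G * L (monomial i.1 1) := by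
  have h1 : G = ∑ i : Idx n d, coeff i.1 G • monomial i.1 (1 : ℂ) := by
    ext m
    simp only [coeff_sum, coeff_smul, coeff_monomial, smul_eq_mul, mul_ite, mul_one, mul_zero]
    by_cases hm : (m.sum fun _ e => e) ≤ d
    · rw [Finset.sum_eq_single (⟨m, hm⟩ : Idx n d)]
      · simp
      · intro b _ hb
        rw [if_neg]
        intro h; exact hb (Subtype.ext h)
      · simp
    · rw [Finset.sum_eq_zero]
      · by_contra h
        exact hm ((le_totalDegree (mem_support_iff.mpr h)).trans hG)
      · intro b _
        rw [if_neg]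
        rintro rfl; exact hm b.2
  conv_lhs => rw [h1]
  simp

theorem aeval_int (z : Fin n → ℂ) (p : MvPolynomial (Fin n) ℤ) :
    aeval z p = eval z (map (Int.castRingHom ℂ) p) := by
  rw [eval_map]; rfl

theorem solve_const {d : ℕ} (c m : Idx n d → ℂ) (hm : m (i0 n d) = 1) (h : ∑ i, c i * m i = 0) :
    c (i0 n d) = - ∑ i, if i.1 = 0 then 0 else c i * m i := by
  rw [← Finset.add_sum_erase _ _ (Finset.mem_univ (i0 n d)), hm, mul_one] at h
  rw [eq_neg_iff_add_eq_zero]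
  refine Eq.trans ?_ h
  rw [← Finset.add_sum_erase (a := i0 n d) Finset.univ (fun i : Idx n d => if i.1 = 0 then 0 else c i * m i) (Finset.mem_univ _)]
  simp only [i0, if_true, zero_add]
  congr 1
  apply Finset.sum_congr rfl
  intro i hi
  rw [if_neg]
  intro h; exact (Finset.mem_erase.mp hi).1 (Subtype.ext h)

theorem cover (hn : 1 ≤ n) (G H : MvPolynomial (Fin n) ℂ) (hG : G.totalDegree ≤ d₁)
    (hH : H.totalDegree ≤ d₂) (z : Fin n → ℂ) (hz : eval z H = 0)
    (hc : ∀ j k, z j * eval z (pderiv j H) = z k * eval z (pderiv k H)) (hGz : eval z G = 0) :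
    ∃ (S : Finset (Fin n)) (y : Idx n d₁ ⊕ Idx n d₂ → ℂ), y (Sum.inl (i0 n d₁)) = 0 ∧
      phi hd S y = Sum.elim (fun i : Idx n d₁ => coeff i.1 G) (fun i : Idx n d₂ => coeff i.1 H) := by
  let S : Finset (Fin n) := Finset.univ.filter (fun k => z k = 0)
  have hS : ∀ k, k ∈ S ↔ z k = 0 := by simp [S]
  let lam := z ⟨0, hn⟩ * eval z (pderiv ⟨0, hn⟩ H)
  let μ := lam / ∏ j ∈ Finset.univ.filter (fun j => j ∉ S), z j
  let y : Idx n d₁ ⊕ Idx n d₂ → ℂ := Sum.elim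
    (fun i => if i.1 = 0 then 0 else coeff i.1 G)
    (fun i => if i.1 = 0 then μ else if h : Lin S i then z h.choose else coeff i.1 H)
  have hchoose : ∀ (i : Idx n d₂) (h : Lin S i) k, i.1 = Finsupp.single k 1 → h.choose = k := by
    intro i h k hk
    have := h.choose_spec.2
    exact (Finsupp.single_left_injective one_ne_zero (hk.symm.trans this)).symm
  have hzz : zz hd S y = z := by
    funext k
    unfold zz
    split_ifs with h
    · exact ((hS k).mp h).symm
    · have hl : Lin S (i1 n d₂ hd k) := ⟨k, h, rfl⟩
      have : (i1 n d₂ hd k).1 ≠ 0 := by simp [i1]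
      simp only [y, Sum.elim_inr, if_neg this, dif_pos hl]
      rw [hchoose _ hl k rfl]
  have hpd : ∀ k, eval z (pderiv k H) =
      ∑ i : Idx n d₂, coeff i.1 H * aeval z (pderiv k (monomial i.1 (1 : ℤ))) := by
    intro k
    have := linear_expand ((aeval z : MvPolynomial (Fin n) ℂ →ₐ[ℂ] ℂ).toLinearMap ∘ₗ
      (pderiv k).toLinearMap) H hH
    simpa [aeval_int, ← pderiv_map, aeval_eq_eval] using this
  have hev : ∀ {d : ℕ} (Q : MvPolynomial (Fin n) ℂ), Q.totalDegree ≤ d → eval z Q =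
      ∑ i : Idx n d, coeff i.1 Q * aeval z (monomial i.1 (1 : ℤ)) := by
    intro d Q hQ
    have := linear_expand ((aeval z : MvPolynomial (Fin n) ℂ →ₐ[ℂ] ℂ).toLinearMap) Q hQ
    simpa [aeval_int, aeval_eq_eval] using this
  have hff : ∀ k, k ∉ S → ff hd S y k = coeff (Finsupp.single k 1) H := by
    intro k hk
    have hk0 : z k ≠ 0 := fun h => hk ((hS k).mpr h)
    have hprod : ∏ j ∈ Finset.univ.filter (fun j => j ∉ S), z j =
        z k * ∏ j ∈ Finset.univ.filter (fun j => j ∉ S ∧ j ≠ k), z j := by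
      rw [← Finset.mul_prod_erase _ _ (show k ∈ Finset.univ.filter (fun j => j ∉ S) by simpa)]
      congr 2
      ext j; simp; tauto
    have hp0 : ∏ j ∈ Finset.univ.filter (fun j => j ∉ S ∧ j ≠ k), z j ≠ 0 := by
      rw [Finset.prod_ne_zero_iff]
      intro j hj
      have := (Finset.mem_filter.mp hj).2.1
      rwa [hS] at this
    have h1 : y (Sum.inr (i0 n d₂)) * ∏ j ∈ Finset.univ.filter (fun j => j ∉ S ∧ j ≠ k), z j
        = eval z (pderiv k H) := by
      have : lam = z k * eval z (pderiv k H) := hc _ _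
      simp only [y, Sum.elim_inr, i0, if_true, μ, this, hprod]
      field_simp
    unfold ff
    rw [hzz, h1, hpd, ← Finset.sum_sub_distrib, Finset.sum_eq_single (i1 n d₂ hd k)]
    · have hl : Lin S (i1 n d₂ hd k) := ⟨k, hk, rfl⟩
      rw [if_pos (Or.inr hl)]
      simp [i1, pderiv_monomial]
    · intro i _ hi
      split_ifs with h
      · have : pderiv k (monomial i.1 (1 : ℤ)) = 0 := by
          rcases h with h | ⟨j, hj, h⟩
          · simp [h, pderiv_monomial]
          · have hjk : k ≠ j := by
              rintro rfl
              exact hi (Subtype.ext h)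
            simp [h, pderiv_monomial, Finsupp.single_apply, hjk.symm]
        simp [this]
      · push Not at h
        simp [y, h.1, h.2]
    · simp
  have hhh : ∀ i : Idx n d₂, i.1 ≠ 0 → hh hd S y i = coeff i.1 H := by
    intro i hi
    unfold hh
    split_ifs with h
    · rw [hff _ h.choose_spec.1]
      exact congrArg (fun m => coeff m H) h.choose_spec.2.symm
    · simp [y, hi, h]
  refine ⟨S, y, by simp [y, i0], ?_⟩
  funext s
  rcases s with i | i
  · simp only [phi, Sum.elim_inl, hzz]
    split_ifs with h
    · rw [hev G hG] at hGz
      have := solve_const (fun i : Idx n d₁ => coeff i.1 G) _ (by simp [i0]) hGz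
      have hi : i = i0 n d₁ := Subtype.ext h
      rw [hi, this]
      congr 1
      apply Finset.sum_congr rfl
      intro j _
      split_ifs with hj
      · rfl
      · simp [y, hj]
    · simp [y, h]
  · simp only [phi, Sum.elim_inr, hzz]
    split_ifs with h
    · rw [hev H hH] at hz
      have := solve_const (fun i : Idx n d₂ => coeff i.1 H) _ (by simp [i0]) hz
      have hi : i = i0 n d₂ := Subtype.ext h
      rw [hi, this]
      congr 1
      apply Finset.sum_congr rfl
      intro j _
      split_ifs with hj
      · rfl
      · rw [hhh j hj]
    · exact hhh i h

end

end Stmt17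

/-- Generically, the numerator `G` does not vanish at any critical point of `G/H`:
    there is a nonzero integer polynomial `P` in the `m_{d₁} + m_{d₂}` coefficient
    variables of the pair `(G, H)` such that whenever `P` does not vanish at the
    combined coefficient vector of `(G, H)` (with `deg G ≤ d₁`, `deg H ≤ d₂`), the
    polynomial `G` is nonzero at every critical point of `H`. -/
theorem stmt17 (n d₁ d₂ : ℕ) (hn : 1 ≤ n) (hd₁ : 1 ≤ d₁) (hd₂ : 1 ≤ d₂) :
    ∃ P : MvPolynomial
        ({i : Fin n →₀ ℕ // (i.sum fun _ e => e) ≤ d₁} ⊕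
         {i : Fin n →₀ ℕ // (i.sum fun _ e => e) ≤ d₂}) ℤ, P ≠ 0 ∧
      ∀ G H : MvPolynomial (Fin n) ℂ, G.totalDegree ≤ d₁ → H.totalDegree ≤ d₂ →
        MvPolynomial.aeval
            (Sum.elim
              (fun i : {i : Fin n →₀ ℕ // (i.sum fun _ e => e) ≤ d₁} =>
                MvPolynomial.coeff i.1 G)
              (fun i : {i : Fin n →₀ ℕ // (i.sum fun _ e => e) ≤ d₂} =>
                MvPolynomial.coeff i.1 H)) P ≠ 0 →
        ∀ z : Fin n → ℂ, eval z H = 0 →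
          (∀ j k, z j * eval z (pderiv j H) = z k * eval z (pderiv k H)) →
          eval z G ≠ 0 := by
  choose P hP hv using fun S : Finset (Fin n) => Stmt17.exists_P (d₁ := d₁) (d₂ := d₂) hd₂ S
  refine ⟨∏ S, P S, Finset.prod_ne_zero_iff.mpr fun S _ => hP S, ?_⟩
  intro G H hG hH hne z hz hc hGz
  obtain ⟨S, y, hy, h⟩ := Stmt17.cover hd₂ hn G H hG hH z hz hc hGz
  apply hne
  rw [map_prod]
  apply Finset.prod_eq_zero (Finset.mem_univ S)
  have := hv S y hy
  rw [h] at this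
  exact this
end

section
/- Fix integers n ≥ 1 and d ≥ 1. There exists a nonzero polynomial P_d with integer coefficients in the m_d coefficient variables such that for every polynomial H ∈ ℂ[z₁,…,z_n] of degree at most d: if P_d does not vanish at the coefficient vector of H, then at every solution (z, λ, t) ∈ ℂ^{n+2} of the system f = (H(z), z₁(∂H/∂z₁)(z) − λ, …, z_n(∂H/∂z_n)(z) − λ, H(t z₁, …, t z_n)) = 0, the (n+2) × (n+2) Jacobian matrix of the n+2 polynomials of f with respect to the n+2 variables (z₁, …, z_n, λ, t) is invertible. -/
open MvPolynomial

/-- The extended critical-point system map associated to `H`: the `n + 2` polynomials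
    `(H(z), z₁ ∂H/∂z₁(z) − λ, …, z_n ∂H/∂z_n(z) − λ, H(t z₁, …, t z_n))` viewed as a
    map of the `n + 2` variables `(z, λ, t)`. -/
noncomputable def extSys {n : ℕ} (H : MvPolynomial (Fin n) ℂ)
    (p : (Fin n → ℂ) × ℂ × ℂ) : ℂ × (Fin n → ℂ) × ℂ :=
  (eval p.1 H,
   fun j => p.1 j * eval p.1 (pderiv j H) - p.2.1,
   eval (fun j => p.2.2 * p.1 j) H)


/-- Extending derivations along formally étale algebras. -/
theorem exists_derivation_ext {S T : Type} [CommRing S] [CommRing T] [Algebra S T]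
    [Algebra.FormallyEtale S T] (d : Derivation ℤ S T) :
    ∃ D : Derivation ℤ T T, ∀ s, D (algebraMap S T s) = d s := by
  let g : TensorProduct S T (Ω[S⁄ℤ]) →ₗ[T] T :=
    (d.liftKaehlerDifferential).liftBaseChange T
  let e := KaehlerDifferential.tensorKaehlerEquivOfFormallyEtale ℤ S T
  refine ⟨(g ∘ₗ e.symm.toLinearMap).compDer (KaehlerDifferential.D ℤ T), fun s => ?_⟩
  have := KaehlerDifferential.tensorKaehlerEquivOfFormallyEtale_symm_D_algebraMap ℤ S T s
  simp [g, e, this]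

theorem exists_partial {σ : Type} [DecidableEq σ] {L : Type} [CommRing L]
    [Algebra (MvPolynomial σ ℤ) L] [Algebra.FormallyEtale (MvPolynomial σ ℤ) L] (i : σ) :
    ∃ D : Derivation ℤ L L, ∀ j,
      D (algebraMap (MvPolynomial σ ℤ) L (X j)) = if j = i then 1 else 0 := by
  obtain ⟨D, hD⟩ := exists_derivation_ext
      (MvPolynomial.mkDerivation ℤ (fun j : σ => if j = i then (1 : L) else 0))
  refine ⟨D, fun j => ?_⟩
  exact (hD (X j)).trans (MvPolynomial.mkDerivation_X _ _ _)

theorem elim_lemma {σ τ ι : Type} [DecidableEq σ] [Finite τ]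
    (F : ι → MvPolynomial τ (MvPolynomial σ ℤ))
    (h : ∀ (L : Type) [Field L] [CharZero L] (φ : MvPolynomial τ (MvPolynomial σ ℤ) →+* L),
      (∀ i, φ (F i) = 0) →
      (∀ i : σ, ∃ D : Derivation ℤ L L, ∀ j, D (φ (C (X j))) = if j = i then 1 else 0) → False) :
    ∃ P : MvPolynomial σ ℤ, P ≠ 0 ∧ C P ∈ Ideal.span (Set.range F) := by
  by_contra hcon
  push Not at hcon
  let R := MvPolynomial σ ℤ
  let K := FractionRing R
  let _ : Algebra (MvPolynomial τ R) (MvPolynomial τ K) := MvPolynomial.algebraMvPolynomial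
  let I := Ideal.span (Set.range F)
  let J : Ideal (MvPolynomial τ K) := I.map (algebraMap (MvPolynomial τ R) (MvPolynomial τ K))
  have hJ : J ≠ ⊤ := by
    rw [IsLocalization.map_algebraMap_ne_top_iff_disjoint
      ((nonZeroDivisors R).map (C (σ := τ))) (MvPolynomial τ K) I]
    rw [Set.disjoint_left]
    rintro _ ⟨P, hP, rfl⟩ hPI
    exact hcon P (nonZeroDivisors.ne_zero hP) hPI
  obtain ⟨M, hM, hJM⟩ := Ideal.exists_le_maximal J hJ
  let L := MvPolynomial τ K ⧸ M
  let _ : Field L := Ideal.Quotient.field M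
  have : Module.Finite K L := finite_of_finite_type_of_isJacobsonRing K L
  have : CharZero K := inferInstance
  have : CharZero L := charZero_of_injective_algebraMap (algebraMap K L).injective
  have : Algebra.FormallyEtale R K := Algebra.FormallyEtale.of_isLocalization (nonZeroDivisors R)
  have : Algebra.FormallyEtale K L := Algebra.FormallyEtale.of_isSeparable K L
  have : Algebra.FormallyEtale R L := Algebra.FormallyEtale.comp R K L
  refine h L ((Ideal.Quotient.mk M).comp (algebraMap (MvPolynomial τ R) (MvPolynomial τ K))) ?_ ?_
  · intro i
    rw [RingHom.comp_apply, Ideal.Quotient.eq_zero_iff_mem]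
    exact hJM (Ideal.mem_map_of_mem _ (Ideal.subset_span ⟨i, rfl⟩))
  · intro i
    obtain ⟨D, hD⟩ := exists_partial (L := L) i
    refine ⟨D, fun j => ?_⟩
    rw [← hD j]
    congr 1
    change Ideal.Quotient.mk M (MvPolynomial.map (algebraMap R K) (C (X j))) = _
    rw [MvPolynomial.map_C]
    rfl

/-- Apply a derivation to all the coefficients of a polynomial. -/
noncomputable def dmap {n : ℕ} {L : Type} [CommRing L] (D : Derivation ℤ L L)
    (H : MvPolynomial (Fin n) L) : MvPolynomial (Fin n) L :=
  ∑ m ∈ H.support, monomial m (D (coeff m H))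

theorem coeff_dmap {n : ℕ} {L : Type} [CommRing L] (D : Derivation ℤ L L)
    (H : MvPolynomial (Fin n) L) (m : Fin n →₀ ℕ) : coeff m (dmap D H) = D (coeff m H) := by
  classical
  simp only [dmap, coeff_sum, coeff_monomial, Finset.sum_ite_eq', mem_support_iff]
  split_ifs with h
  · rfl
  · simp at h
    simp [h]

theorem dmap_add {n : ℕ} {L : Type} [CommRing L] (D : Derivation ℤ L L)
    (H G : MvPolynomial (Fin n) L) : dmap D (H + G) = dmap D H + dmap D G := by
  ext m; simp [coeff_dmap]

theorem dmap_sum {n : ℕ} {L : Type} [CommRing L] (D : Derivation ℤ L L) {ι : Type}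
    (s : Finset ι) (H : ι → MvPolynomial (Fin n) L) :
    dmap D (∑ i ∈ s, H i) = ∑ i ∈ s, dmap D (H i) := by
  ext m; simp [coeff_dmap, coeff_sum]

theorem dmap_monomial {n : ℕ} {L : Type} [CommRing L] (D : Derivation ℤ L L)
    (m : Fin n →₀ ℕ) (a : L) : dmap D (monomial m a) = monomial m (D a) := by
  classical
  ext k
  simp only [coeff_dmap, coeff_monomial]
  split_ifs <;> simp

theorem dmap_pderiv {n : ℕ} {L : Type} [CommRing L] (D : Derivation ℤ L L) (j : Fin n)
    (H : MvPolynomial (Fin n) L) : dmap D (pderiv j H) = pderiv j (dmap D H) := by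
  induction H using MvPolynomial.induction_on' with
  | monomial m a => simp [pderiv_monomial, dmap_monomial, mul_comm]
  | add p q hp hq => simp [dmap_add, hp, hq]

theorem deriv_eval {n : ℕ} {L : Type} [CommRing L] (D : Derivation ℤ L L)
    (H : MvPolynomial (Fin n) L) (z : Fin n → L) :
    D (eval z H) = eval z (dmap D H) + ∑ j, eval z (pderiv j H) * D (z j) := by
  induction H using MvPolynomial.induction_on with
  | C a =>
    have : dmap D (C a : MvPolynomial (Fin n) L) = C (D a) := dmap_monomial D 0 a
    simp [this]
  | add p q hp hq =>
    simp only [map_add, dmap_add, hp, hq, add_mul, Finset.sum_add_distrib]; ring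
  | mul_X p i hp =>
    have : dmap D (p * X i) = dmap D p * X i := by
      classical
      ext m
      simp only [coeff_dmap, coeff_mul_X']
      split_ifs <;> simp
    simp only [map_mul, eval_X, Derivation.leibniz, hp, this, smul_eq_mul, map_add,
      add_mul, Finset.sum_add_distrib]
    have h1 : ∑ x : Fin n, eval z p * eval z (pderiv x (X i : MvPolynomial (Fin n) L)) * D (z x)
        = eval z p * D (z i) := by
      rw [Finset.sum_eq_single i]
      · simp
      · intro k _ hk
        simp [pderiv_X_of_ne hk.symm]
      · simp
    rw [h1]
    simp only [mul_add, Finset.mul_sum, mul_assoc]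
    ring

/-- The generic elimination of the dual vector. -/
theorem bad_star {n : ℕ} {L : Type} [CommRing L] (D : Derivation ℤ L L)
    (H : MvPolynomial (Fin n) L) (z b : Fin n → L) (lam t a s : L)
    (h1 : eval z H = 0) (h2 : ∀ j, z j * eval z (pderiv j H) - lam = 0)
    (h3 : eval (fun j => t * z j) H = 0)
    (h4 : ∀ k, (a + b k) * eval z (pderiv k H) + ∑ j, b j * (z j * eval z (pderiv k (pderiv j H)))
      + s * (t * eval (fun j => t * z j) (pderiv k H)) = 0)
    (h5 : ∑ j, b j = 0)
    (h6 : s * ∑ j, z j * eval (fun j => t * z j) (pderiv j H) = 0) :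
    a * eval z (dmap D H) + ∑ j, b j * (z j * eval z (pderiv j (dmap D H)))
      + s * eval (fun j => t * z j) (dmap D H) = 0 := by
  have e1 : eval z (dmap D H) + ∑ j, eval z (pderiv j H) * D (z j) = 0 := by
    rw [← deriv_eval, h1, map_zero]
  have e2 : ∀ j, z j * (eval z (pderiv j (dmap D H))
      + ∑ k, eval z (pderiv k (pderiv j H)) * D (z k)) + eval z (pderiv j H) * D (z j)
      - D lam = 0 := by
    intro j
    have := congrArg D (h2 j)
    rw [map_sub, map_zero, Derivation.leibniz, deriv_eval, dmap_pderiv] at this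
    simpa using this
  have e3 : eval (fun j => t * z j) (dmap D H)
      + ∑ j, eval (fun j => t * z j) (pderiv j H) * (t * D (z j) + z j * D t) = 0 := by
    have := congrArg D h3
    rw [deriv_eval] at this
    simpa using this
  have e2' : ∑ j, b j * (z j * (eval z (pderiv j (dmap D H))
      + ∑ k, eval z (pderiv k (pderiv j H)) * D (z k)) + eval z (pderiv j H) * D (z j)
      - D lam) = 0 := by simp [e2]
  have e4 : ∑ k, ((a + b k) * eval z (pderiv k H)
      + ∑ j, b j * (z j * eval z (pderiv k (pderiv j H)))
      + s * (t * eval (fun j => t * z j) (pderiv k H))) * D (z k) = 0 := by simp [h4]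
  have e5 : (∑ j, b j) * D lam = 0 := by rw [h5, zero_mul]
  have e6 : (s * ∑ j, z j * eval (fun j => t * z j) (pderiv j H)) * D t = 0 := by
    rw [h6, zero_mul]
  simp only [mul_add, mul_sub, add_mul, Finset.sum_add_distrib, Finset.sum_sub_distrib,
    Finset.mul_sum, Finset.sum_mul] at e1 e2' e3 e4 e5 e6 ⊢
  rw [Finset.sum_comm] at e2'
  have e1a := congrArg (a * ·) e1
  have e3a := congrArg (s * ·) e3
  simp only [mul_add, Finset.mul_sum, mul_zero, ← mul_assoc] at e1a e2' e3a e4 e5 e6 ⊢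
  have r1 : ∀ x, s * eval (fun j => t * z j) (pderiv x H) * t * D (z x)
     = s * t * eval (fun j => t * z j) (pderiv x H) * D (z x) := fun x => by ring
  have r2 : ∀ x, s * eval (fun j => t * z j) (pderiv x H) * z x * D t
     = s * z x * eval (fun j => t * z j) (pderiv x H) * D t := fun x => by ring
  simp only [r1, r2] at e3a
  linear_combination e1a + e2' + e3a - e4 + e5 - e6

/-- The set of exponents of degree at most `d`. -/
abbrev Expo (n d : ℕ) : Type := {i : Fin n →₀ ℕ // (i.sum fun _ e => e) ≤ d}

noncomputable instance instFintypeExpo (n d : ℕ) : Fintype (Expo n d) := by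
  have : Finite (Expo n d) := by
    refine Finite.of_injective
      (fun i : Expo n d => fun j : Fin n => (⟨i.1 j, ?_⟩ : Fin (d + 1))) ?_
    · have h := i.2
      rw [Finsupp.sum_fintype _ _ (by simp)] at h
      have := Finset.single_le_sum (f := fun j => i.1 j) (fun _ _ => Nat.zero_le _)
        (Finset.mem_univ j)
      omega
    · intro i k h
      ext j
      have := congrFun h j
      simpa using this
  exact Fintype.ofFinite _

/-- The polynomial with coefficients `c`. -/
noncomputable def polyOf {n d : ℕ} {A : Type} [CommRing A] (c : Expo n d → A) :
    MvPolynomial (Fin n) A := ∑ i, monomial i.1 (c i)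

theorem polyOf_coeff {n d : ℕ} {A : Type} [CommRing A] (H : MvPolynomial (Fin n) A)
    (hH : H.totalDegree ≤ d) : polyOf (fun i : Expo n d => coeff i.1 H) = H := by
  classical
  ext m
  simp only [polyOf, coeff_sum, coeff_monomial]
  by_cases hm : (m.sum fun _ e => e) ≤ d
  · rw [Finset.sum_eq_single (⟨m, hm⟩ : Expo n d)]
    · simp
    · intro k _ hk
      rw [if_neg]
      intro h
      exact hk (Subtype.ext h)
    · simp
  · rw [Finset.sum_eq_zero]
    · symm
      apply coeff_eq_zero_of_totalDegree_lt
      simp only [Finsupp.sum] at hm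
      omega
    · intro k _
      rw [if_neg]
      rintro rfl
      exact hm k.2

theorem dmap_polyOf {n d : ℕ} {L : Type} [CommRing L] [DecidableEq (Expo n d)]
    (D : Derivation ℤ L L)
    (c : Expo n d → L) (i : Expo n d) (h : ∀ j, D (c j) = if j = i then 1 else 0) :
    dmap D (polyOf c) = monomial i.1 1 := by
  rw [polyOf, dmap_sum]
  simp only [dmap_monomial, h]
  rw [Finset.sum_eq_single i] <;> simp +contextual

theorem no_bad {n d : ℕ} (hn : 1 ≤ n) (hd : 1 ≤ d) {L : Type} [Field L] [CharZero L]
    [DecidableEq (Expo n d)] (c : Expo n d → L)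
    (hD : ∀ i, ∃ D : Derivation ℤ L L, ∀ j, D (c j) = if j = i then 1 else 0)
    (z b : Fin n → L) (lam t a s : L)
    (h1 : eval z (polyOf c) = 0) (h2 : ∀ j, z j * eval z (pderiv j (polyOf c)) - lam = 0)
    (h3 : eval (fun j => t * z j) (polyOf c) = 0)
    (h4 : ∀ k, (a + b k) * eval z (pderiv k (polyOf c))
      + ∑ j, b j * (z j * eval z (pderiv k (pderiv j (polyOf c))))
      + s * (t * eval (fun j => t * z j) (pderiv k (polyOf c))) = 0)
    (h5 : ∑ j, b j = 0)
    (h6 : s * ∑ j, z j * eval (fun j => t * z j) (pderiv j (polyOf c)) = 0) :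
    a = 0 ∧ s = 0 ∧ ∀ j, b j = 0 := by
  -- the derivation for the constant coefficient
  obtain ⟨D0, hD0⟩ := hD ⟨0, by simp⟩
  have hE0 := dmap_polyOf D0 c _ hD0
  -- `lam` is non-zero
  have hlam : lam ≠ 0 := by
    rintro rfl
    have := deriv_eval D0 (polyOf c) z
    rw [h1, hE0, map_zero, Finset.sum_eq_zero] at this
    · simp at this
    · intro j _
      have h := h2 j
      rw [sub_zero, mul_eq_zero] at h
      rcases h with h | h <;> simp [h]
  have hz : ∀ j, z j ≠ 0 := by
    intro j hj
    have := h2 j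
    rw [hj] at this
    apply hlam
    simpa using this
  have s0 := bad_star D0 (polyOf c) z b lam t a s h1 h2 h3 h4 h5 h6
  rw [hE0] at s0
  have s0' : a + s = 0 := by simpa [pderiv_monomial] using s0
  have s1 : ∀ k, a + b k + s * t = 0 := by
    intro k
    obtain ⟨D, hDk⟩ := hD ⟨Finsupp.single k 1, by simpa using hd⟩
    have hE := dmap_polyOf D c _ hDk
    have st := bad_star D (polyOf c) z b lam t a s h1 h2 h3 h4 h5 h6
    rw [hE] at st
    have hX : (monomial (Finsupp.single k 1) 1 : MvPolynomial (Fin n) L) = X k := rfl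
    simp only [hX, eval_X] at st
    rw [Finset.sum_eq_single k] at st
    · simp only [pderiv_X_self, map_one] at st
      have : (a + b k + s * t) * z k = 0 := by linear_combination st
      exact (mul_eq_zero.mp this).resolve_right (hz k)
    · intro j _ hj
      simp [pderiv_X_of_ne hj.symm]
    · simp
  have hb : ∀ k, b k = a * (t - 1) := fun k => by linear_combination s1 k - t * s0'
  have hn0 : (n : L) ≠ 0 := by
    rw [Nat.cast_ne_zero]
    omega
  have h5' : (n : L) * (a * (t - 1)) = 0 := by
    simpa [hb] using h5
  have h5'' := (mul_eq_zero.mp h5').resolve_left hn0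
  have ha : a = 0 := by
    rcases mul_eq_zero.mp h5'' with h | h
    · exact h
    · have ht : t = 1 := by linear_combination h
      have hs : s = 0 := by
        have h2' : ∀ j, z j * eval z (pderiv j (polyOf c)) = lam := fun j => by
          linear_combination h2 j
        simp only [ht, one_mul] at h6
        have : s * ((n : L) * lam) = 0 := by simpa [h2'] using h6
        exact (mul_eq_zero.mp this).resolve_right (mul_ne_zero hn0 hlam)
      linear_combination s0' - hs
  refine ⟨ha, by linear_combination s0' - ha, fun j => by rw [hb, ha, zero_mul]⟩

/-- The unknowns: `(0, j)` is `z j`, `(1, j)` is `b j`, `(2, j)` an auxiliary inverse for `b j`;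
`0, 1, 2, 3` are `lam, t, a, s` and `4, 5` auxiliary inverses for `a, s`. -/
abbrev Unk (n : ℕ) : Type := (Fin 3 × Fin n) ⊕ Fin 6

/-- The indices of the equations. -/
abbrev EqIdx (n : ℕ) : Type := (Fin 2 × Fin n) ⊕ Fin 5

/-- The equations of the bad locus, over an arbitrary ring. -/
noncomputable def eqs {n : ℕ} {A : Type} [CommRing A] (H : MvPolynomial (Fin n) A)
    (q : Unk n → A) : EqIdx n → A
  | Sum.inl (0, j) => q (.inl (0, j)) * eval (fun j => q (.inl (0, j))) (pderiv j H) - q (.inr 0)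
  | Sum.inl (1, k) => (q (.inr 2) + q (.inl (1, k))) * eval (fun j => q (.inl (0, j))) (pderiv k H)
      + ∑ j, q (.inl (1, j)) * (q (.inl (0, j)) *
        eval (fun j => q (.inl (0, j))) (pderiv k (pderiv j H)))
      + q (.inr 3) * (q (.inr 1) * eval (fun j => q (.inr 1) * q (.inl (0, j))) (pderiv k H))
  | Sum.inr 0 => eval (fun j => q (.inl (0, j))) H
  | Sum.inr 1 => eval (fun j => q (.inr 1) * q (.inl (0, j))) H
  | Sum.inr 2 => ∑ j, q (.inl (1, j))
  | Sum.inr 3 => q (.inr 3) *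
      ∑ j, q (.inl (0, j)) * eval (fun j => q (.inr 1) * q (.inl (0, j))) (pderiv j H)
  | Sum.inr 4 => q (.inr 2) * q (.inr 4) + q (.inr 3) * q (.inr 5)
      + ∑ j, q (.inl (1, j)) * q (.inl (2, j)) - 1

theorem hom_eval {n : ℕ} {A B : Type} [CommRing A] [CommRing B] (φ : A →+* B)
    (z : Fin n → A) (H : MvPolynomial (Fin n) A) :
    φ (eval z H) = eval (fun j => φ (z j)) (map φ H) := by
  rw [eval_map, eval₂_comp]
  rfl

theorem eqs_map {n : ℕ} {A B : Type} [CommRing A] [CommRing B] (φ : A →+* B)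
    (H : MvPolynomial (Fin n) A) (q : Unk n → A) (i : EqIdx n) :
    φ (eqs H q i) = eqs (map φ H) (fun u => φ (q u)) i := by
  match i with
  | Sum.inl (0, j) => simp [eqs, hom_eval, pderiv_map]
  | Sum.inl (1, k) => simp [eqs, hom_eval, pderiv_map]
  | Sum.inr 0 => simp [eqs, hom_eval]
  | Sum.inr 1 => simp [eqs, hom_eval]
  | Sum.inr 2 => simp [eqs]
  | Sum.inr 3 => simp [eqs, hom_eval, pderiv_map]
  | Sum.inr 4 => simp [eqs]

theorem map_polyOf {n d : ℕ} {A B : Type} [CommRing A] [CommRing B] (φ : A →+* B)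
    (c : Expo n d → A) : map φ (polyOf c) = polyOf (fun i => φ (c i)) := by
  simp [polyOf, map_monomial]

theorem exists_elim (n d : ℕ) (hn : 1 ≤ n) (hd : 1 ≤ d) :
    ∃ P : MvPolynomial (Expo n d) ℤ, P ≠ 0 ∧ ∀ (c : Expo n d → ℂ) (q : Unk n → ℂ),
      (∀ i, eqs (polyOf c) q i = 0) → aeval c P = 0 := by
  classical
  let F : EqIdx n → MvPolynomial (Unk n) (MvPolynomial (Expo n d) ℤ) :=
    eqs (polyOf (fun i : Expo n d => C (X i))) (fun u => X u)
  obtain ⟨P, hP, hPF⟩ := elim_lemma F (by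
    intro L _ _ φ hφ hD
    have hq : ∀ i, eqs (polyOf (fun i : Expo n d => φ (C (X i)))) (fun u => φ (X u)) i = 0 := by
      intro i
      rw [← hφ i, eqs_map, map_polyOf]
    have := no_bad hn hd (fun i : Expo n d => φ (C (X i))) hD
      (fun j => φ (X (.inl (0, j)))) (fun j => φ (X (.inl (1, j))))
      (φ (X (.inr 0))) (φ (X (.inr 1))) (φ (X (.inr 2))) (φ (X (.inr 3)))
      (hq (.inr 0)) (fun j => hq (.inl (0, j))) (hq (.inr 1)) (fun j => hq (.inl (1, j)))
      (hq (.inr 2)) (hq (.inr 3))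
    obtain ⟨ha, hs, hb⟩ := this
    have h4 := hq (.inr 4)
    simp [eqs, ha, hs, hb] at h4)
  refine ⟨P, hP, fun c q h => ?_⟩
  let φ : MvPolynomial (Unk n) (MvPolynomial (Expo n d) ℤ) →+* ℂ :=
    eval₂Hom (aeval c : MvPolynomial (Expo n d) ℤ →ₐ[ℤ] ℂ).toRingHom q
  have hker : Ideal.span (Set.range F) ≤ RingHom.ker φ := by
    rw [Ideal.span_le]
    rintro _ ⟨i, rfl⟩
    change φ (F i) = 0
    rw [eqs_map, map_polyOf]
    simpa [φ] using h i
  have := hker hPF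
  rw [RingHom.mem_ker] at this
  simpa [φ] using this

theorem hasFDerivAt_eval {n : ℕ} {V : Type} [NormedAddCommGroup V] [NormedSpace ℂ V]
    (H : MvPolynomial (Fin n) ℂ) (f : V → Fin n → ℂ) (f' : Fin n → V →L[ℂ] ℂ) (x : V)
    (hf : ∀ j, HasFDerivAt (fun p => f p j) (f' j) x) :
    HasFDerivAt (fun p => eval (f p) H) (∑ j, eval (f x) (pderiv j H) • f' j) x := by
  induction H using MvPolynomial.induction_on with
  | C a =>
    simp only [eval_C]
    refine (hasFDerivAt_const a x).congr_fderiv ?_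
    ext v
    simp
  | add p q hp hq =>
    simp only [map_add]
    refine (hp.fun_add hq).congr_fderiv ?_
    ext v
    simp [add_mul, Finset.sum_add_distrib]
  | mul_X p i hp =>
    have := hp.fun_mul (hf i)
    simp only [map_mul, eval_X]
    refine this.congr_fderiv ?_
    ext v
    have h1 : ∑ k : Fin n, eval (f x) p * eval (f x) (pderiv k (X i : MvPolynomial (Fin n) ℂ))
        * f' k v = eval (f x) p * f' i v := by
      rw [Finset.sum_eq_single i]
      · simp
      · intro k _ hk
        simp [pderiv_X_of_ne hk.symm]
      · simp
    simp only [Derivation.leibniz, smul_eq_mul, map_add, map_mul, eval_X,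
      _root_.sum_apply, _root_.add_apply, _root_.smul_apply,
      add_mul, Finset.sum_add_distrib, h1, Finset.mul_sum, mul_assoc]
    simp only [← mul_assoc, h1]

theorem exists_dual {n : ℕ} (H : MvPolynomial (Fin n) ℂ) (p : (Fin n → ℂ) × ℂ × ℂ)
    (hp : extSys H p = 0) (hb : ¬ Function.Bijective (fderiv ℂ (extSys H) p)) :
    ∃ q : Unk n → ℂ, ∀ i, eqs H q i = 0 := by
  classical
  obtain ⟨z, lam, t⟩ := p
  -- differentiability
  let pz : Fin n → ((Fin n → ℂ) × ℂ × ℂ) →L[ℂ] ℂ := fun j =>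
    (ContinuousLinearMap.proj j).comp (ContinuousLinearMap.fst ℂ (Fin n → ℂ) (ℂ × ℂ))
  let pl : ((Fin n → ℂ) × ℂ × ℂ) →L[ℂ] ℂ :=
    (ContinuousLinearMap.fst ℂ ℂ ℂ).comp (ContinuousLinearMap.snd ℂ (Fin n → ℂ) (ℂ × ℂ))
  let pt : ((Fin n → ℂ) × ℂ × ℂ) →L[ℂ] ℂ :=
    (ContinuousLinearMap.snd ℂ ℂ ℂ).comp (ContinuousLinearMap.snd ℂ (Fin n → ℂ) (ℂ × ℂ))
  have dz : ∀ j, HasFDerivAt (fun p : (Fin n → ℂ) × ℂ × ℂ => p.1 j) (pz j) (z, lam, t) :=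
    fun j => (pz j).hasFDerivAt
  have dl : HasFDerivAt (fun p : (Fin n → ℂ) × ℂ × ℂ => p.2.1) pl (z, lam, t) := pl.hasFDerivAt
  have dt : HasFDerivAt (fun p : (Fin n → ℂ) × ℂ × ℂ => p.2.2) pt (z, lam, t) := pt.hasFDerivAt
  have d1 := hasFDerivAt_eval H (fun p : (Fin n → ℂ) × ℂ × ℂ => p.1) pz (z, lam, t) dz
  have d2 := fun j => ((dz j).fun_mul (hasFDerivAt_eval (pderiv j H)
    (fun p : (Fin n → ℂ) × ℂ × ℂ => p.1) pz (z, lam, t) dz)).fun_sub dl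
  have d3 := hasFDerivAt_eval H (fun p : (Fin n → ℂ) × ℂ × ℂ => fun j => p.2.2 * p.1 j) _
    (z, lam, t) (fun j => dt.fun_mul (dz j))
  have dd := (d1.prodMk ((hasFDerivAt_pi.2 d2).prodMk d3)).fderiv
  change fderiv ℂ (extSys H) (z, lam, t) = _ at dd
  set T := fderiv ℂ (extSys H) (z, lam, t) with hT
  -- not surjective
  have hns : ¬ Function.Surjective T.toLinearMap := by
    intro hs
    apply hb
    have hfr : Module.finrank ℂ ((Fin n → ℂ) × ℂ × ℂ) = Module.finrank ℂ (ℂ × (Fin n → ℂ) × ℂ) := by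
      simp
      ring
    exact ⟨(LinearMap.injective_iff_surjective_of_finrank_eq_finrank hfr).2 hs, hs⟩
  have hlt : LinearMap.range T.toLinearMap < ⊤ := by
    rw [lt_top_iff_ne_top]
    intro h
    exact hns (LinearMap.range_eq_top.1 h)
  obtain ⟨ψ, hψ0, hψ⟩ := Submodule.exists_le_ker_of_lt_top _ hlt
  have hψT : ∀ v, ψ (T v) = 0 := fun v => hψ ⟨v, rfl⟩
  let a := ψ (1, 0, 0)
  let b : Fin n → ℂ := fun j => ψ (0, Pi.single j 1, 0)
  let s := ψ (0, 0, 1)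
  have hψe : ∀ x y r, ψ (x, y, r) = a * x + ∑ j, b j * y j + s * r := by
    intro x y r
    have : (x, y, r) = x • ((1, 0, 0) : ℂ × (Fin n → ℂ) × ℂ)
        + ∑ j, y j • ((0, Pi.single j 1, 0) : ℂ × (Fin n → ℂ) × ℂ)
        + r • ((0, 0, 1) : ℂ × (Fin n → ℂ) × ℂ) := by
      refine Prod.ext ?_ (Prod.ext ?_ ?_)
      · simp [Prod.fst_sum]
      · ext k
        simp [Prod.fst_sum, Prod.snd_sum, Pi.single_apply]
      · simp [Prod.snd_sum]
    rw [this]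
    simp only [map_add, map_sum, map_smul, smul_eq_mul, a, b, s]
    simp only [mul_comm]
  have hψT' : ∀ v w r, ψ (T (v, w, r)) = 0 := fun v w r => hψT _
  rw [dd] at hψT'
  simp [hψe, pz, pl, pt] at hψT'
  have hex : ∃ wa ws : ℂ, ∃ wb : Fin n → ℂ, a * wa + s * ws + ∑ j, b j * wb j = 1 := by
    obtain ⟨⟨x, y, r⟩, hv⟩ : ∃ v, ψ v ≠ 0 := by
      by_contra h
      push Not at h
      exact hψ0 (LinearMap.ext h)
    refine ⟨x / ψ (x, y, r), r / ψ (x, y, r), fun j => y j / ψ (x, y, r), ?_⟩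
    have := hψe x y r
    simp only [← mul_div_assoc, ← Finset.sum_div, ← add_div]
    rw [div_eq_one_iff_eq hv, this]
    ring
  obtain ⟨wa, ws, wb, hw⟩ := hex
  refine ⟨Sum.elim (fun u => ![z u.2, b u.2, wb u.2] u.1) ![lam, t, a, s, wa, ws], ?_⟩
  simp only [extSys, Prod.mk_eq_zero, funext_iff, Pi.zero_apply] at hp
  obtain ⟨g1, g2, g3⟩ := hp
  intro i
  match i with
  | Sum.inl (0, j) => simpa [eqs] using g2 j
  | Sum.inl (1, k) =>
    have := hψT' (Pi.single k 1) 0 0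
    simp only [Pi.single_apply, mul_ite, mul_one, mul_zero, Finset.sum_ite_eq', Finset.mem_univ,
      if_true, mul_add, sub_zero, add_zero, Finset.sum_add_distrib] at this
    simp only [eqs, Sum.elim_inl, Sum.elim_inr, Matrix.cons_val]
    linear_combination this
  | Sum.inr 0 => simpa [eqs] using g1
  | Sum.inr 1 => simpa [eqs] using g3
  | Sum.inr 2 =>
    have := hψT' 0 1 0
    simpa [eqs] using this
  | Sum.inr 3 =>
    have := hψT' 0 0 1
    simpa [eqs, mul_comm] using this
  | Sum.inr 4 => simp [eqs, hw]

/-- Generically, the Jacobian of the extended critical-point system is non-singular at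
    every solution: there is a nonzero integer polynomial `P_d` in the `m_d` coefficient
    variables such that whenever `P_d` does not vanish at the coefficient vector of `H`
    (of degree at most `d`), at every solution of the extended system the
    `(n+2) × (n+2)` Jacobian matrix (that is, the complex differential of the system
    map) is invertible. -/
theorem stmt18 (n d : ℕ) (hn : 1 ≤ n) (hd : 1 ≤ d) :
    ∃ P : MvPolynomial {i : Fin n →₀ ℕ // (i.sum fun _ e => e) ≤ d} ℤ, P ≠ 0 ∧
      ∀ H : MvPolynomial (Fin n) ℂ, H.totalDegree ≤ d →
        MvPolynomial.aeval
            (fun i : {i : Fin n →₀ ℕ // (i.sum fun _ e => e) ≤ d} =>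
              MvPolynomial.coeff i.1 H) P ≠ 0 →
        ∀ p : (Fin n → ℂ) × ℂ × ℂ, extSys H p = 0 →
          Function.Bijective (fderiv ℂ (extSys H) p) := by
  obtain ⟨P, hP, h⟩ := exists_elim n d hn hd
  refine ⟨P, hP, fun H hH hne p hp => ?_⟩
  by_contra hb
  obtain ⟨q, hq⟩ := exists_dual H p hp hb
  apply hne
  refine h _ q ?_
  rw [polyOf_coeff H hH]
  exact hq
end
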